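/- arXiv:0808.0097 — 5 statements merged into one kernel-verified Lean document; each statement's English description precedes it below -/
import Mathlib

section
/- Let R, S ∈ ℝ[X] be nonzero coprime polynomials and a ∈ ℝ. Then the local Cauchy index of the logarithmic derivative of f = R/S satisfies Ind_a((R'·S − R·S')/(R·S)) = +1 if R(a) = 0, −1 if S(a) = 0, and 0 otherwise. (Here (R'·S − R·S')/(R·S) represents the logarithmic derivative f'/f of f = R/S, and R', S' denote derivatives.) -/
open Polynomial

/-- The value at `x` of the "unit part" of `P` after removing the factor `(X - x)^m`,
where `m` is the multiplicity of `x` as a root of `P`. Nonzero whenever `P ≠ 0`. -/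
noncomputable def unitEval (P : Polynomial ℝ) (x : ℝ) : ℝ :=
  (P /ₘ (X - C x) ^ rootMultiplicity x P).eval x

/-- One-sided Cauchy index `Ind_x^+` of the rational function `R/S` at `x`. -/
noncomputable def indPlus (R S : Polynomial ℝ) (x : ℝ) : ℝ :=
  if (rootMultiplicity x R : ℤ) < (rootMultiplicity x S : ℤ) then
    (1 / 2) * Real.sign (unitEval R x * unitEval S x)
  else 0

/-- One-sided Cauchy index `Ind_x^-` of the rational function `R/S` at `x`. -/
noncomputable def indMinus (R S : Polynomial ℝ) (x : ℝ) : ℝ :=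
  if (rootMultiplicity x R : ℤ) < (rootMultiplicity x S : ℤ) then
    (1 / 2) * (-1 : ℝ) ^ (rootMultiplicity x S - rootMultiplicity x R) *
      Real.sign (unitEval R x * unitEval S x)
  else 0

/-- Local Cauchy index `Ind_x(R/S) = Ind_x^+(R/S) - Ind_x^-(R/S)`. -/
noncomputable def indPoint (R S : Polynomial ℝ) (x : ℝ) : ℝ :=
  indPlus R S x - indMinus R S x

/-- The Cauchy index `Ind_a^b(R/S)` of the rational function `R/S` on `[a, b]`:
`Ind_a^+(R/S) + Σ_{x ∈ (a,b)} Ind_x(R/S) - Ind_b^-(R/S)`, with the convention that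
it is `0` when `R = 0` or `S = 0`.  (Only poles, i.e. roots of `S`, contribute to
the middle sum.) -/
noncomputable def cauchyIndex (R S : Polynomial ℝ) (a b : ℝ) : ℝ :=
  if R = 0 ∨ S = 0 then 0
  else indPlus R S a +
      (∑ x ∈ S.roots.toFinset, if a < x ∧ x < b then indPoint R S x else 0) -
      indMinus R S b

/-- Number of sign changes `V(s_0, …, s_n) = Σ ½|sign s_{k-1} - sign s_k|` of a list of reals. -/
noncomputable def signVar : List ℝ → ℝ
  | [] => 0
  | [_] => 0
  | a :: b :: l => (1 / 2) * |Real.sign a - Real.sign b| + signVar (b :: l)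

/-- Sign changes `V_x(S_0, …, S_n)` of a list of real polynomials evaluated at `x`. -/
noncomputable def signVarAt (L : List (Polynomial ℝ)) (x : ℝ) : ℝ :=
  signVar (L.map fun P => P.eval x)

theorem rootMultiplicity_X_sub_C_pow_mul {Q : Polynomial ℝ} {a : ℝ} (hQ : Q.eval a ≠ 0) (m : ℕ) :
    rootMultiplicity a ((X - C a) ^ m * Q) = m := by
  have hQ0 : Q ≠ 0 := by rintro rfl; simp at hQ
  rw [mul_comm, rootMultiplicity_mul_X_sub_C_pow hQ0, rootMultiplicity_eq_zero hQ, zero_add]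

theorem unitEval_X_sub_C_pow_mul {Q : Polynomial ℝ} {a : ℝ} (hQ : Q.eval a ≠ 0) (m : ℕ) :
    unitEval ((X - C a) ^ m * Q) a = Q.eval a := by
  rw [unitEval, rootMultiplicity_X_sub_C_pow_mul hQ,
    mul_divByMonic_cancel_left _ ((monic_X_sub_C a).pow m)]

/-- At a simple pole the local Cauchy index is the sign of the residue. -/
theorem indPoint_of_simple_pole {U V : Polynomial ℝ} {a : ℝ} (hU : U.eval a ≠ 0)
    (hV : V.eval a ≠ 0) (m : ℕ) :
    indPoint ((X - C a) ^ m * U) ((X - C a) ^ (m + 1) * V) a =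
      Real.sign (U.eval a * V.eval a) := by
  simp only [indPoint, indPlus, indMinus, rootMultiplicity_X_sub_C_pow_mul hU,
    rootMultiplicity_X_sub_C_pow_mul hV, unitEval_X_sub_C_pow_mul hU,
    unitEval_X_sub_C_pow_mul hV]
  rw [if_pos (by simp), if_pos (by simp), Nat.add_sub_cancel_left]
  ring

/-- Near a zero `a` of `R/S`, the logarithmic derivative of `R/S` has a simple pole with
positive residue. -/
theorem exists_logDeriv_factorization_of_root {R S : Polynomial ℝ} {a : ℝ} (hR : R ≠ 0)
    (hRa : R.eval a = 0) (hSa : S.eval a ≠ 0) :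
    ∃ (m : ℕ) (U V : Polynomial ℝ), 0 < U.eval a * V.eval a ∧
      R.derivative * S - R * S.derivative = (X - C a) ^ m * U ∧
      R * S = (X - C a) ^ (m + 1) * V := by
  obtain ⟨r, hr, hdvd⟩ := exists_eq_pow_rootMultiplicity_mul_and_not_dvd R hR a
  obtain ⟨m, hm⟩ := Nat.exists_eq_add_one_of_ne_zero ((rootMultiplicity_pos hR).2 hRa).ne'
  rw [hm] at hr
  have hra : r.eval a ≠ 0 := fun h => hdvd (dvd_iff_isRoot.2 h)
  refine ⟨m, C (m + 1 : ℝ) * (r * S) + (X - C a) * (r.derivative * S - r * S.derivative),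
    r * S, ?_, ?_, by rw [hr, mul_assoc]⟩
  · have := mul_self_pos.2 (mul_ne_zero hra hSa)
    simp only [eval_add, eval_mul, eval_sub, eval_C, eval_X, sub_self, zero_mul, add_zero, mul_assoc]
    simp only [mul_assoc] at this
    positivity
  · rw [hr, derivative_mul, derivative_X_sub_C_pow]
    simp only [Nat.add_sub_cancel, Nat.cast_add, Nat.cast_one, map_add, map_natCast, map_one]
    ring

/-- The local Cauchy index of the logarithmic derivative `f'/f = (R'S - RS')/(RS)` of
`f = R/S` at `a` is `+1` at a zero of `f`, `-1` at a pole of `f`, and `0` otherwise. -/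
theorem indPoint_logDeriv (R S : Polynomial ℝ) (hR : R ≠ 0) (hS : S ≠ 0)
    (hcop : IsCoprime R S) (a : ℝ) :
    indPoint (R.derivative * S - R * S.derivative) (R * S) a =
      if R.eval a = 0 then 1 else if S.eval a = 0 then -1 else 0 := by
  split_ifs with hRa hSa
  · have hSa : S.eval a ≠ 0 := fun hSa => by
      obtain ⟨u, v, huv⟩ := hcop
      simpa [hRa, hSa] using congrArg (eval a) huv
    obtain ⟨m, U, V, hpos, hnum, hden⟩ := exists_logDeriv_factorization_of_root hR hRa hSa
    rw [hnum, hden, indPoint_of_simple_pole (left_ne_zero_of_mul hpos.ne')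
      (right_ne_zero_of_mul hpos.ne'), Real.sign_of_pos hpos]
  · obtain ⟨m, U, V, hpos, hnum, hden⟩ := exists_logDeriv_factorization_of_root hS hSa hRa
    have hneg : R.derivative * S - R * S.derivative = (X - C a) ^ m * -U := by
      rw [mul_neg, ← hnum]
      ring
    rw [hneg, mul_comm R S, hden, indPoint_of_simple_pole
      (by simpa using left_ne_zero_of_mul hpos.ne') (right_ne_zero_of_mul hpos.ne'), eval_neg,
      neg_mul, Real.sign_neg, Real.sign_of_pos hpos]
  · have h : rootMultiplicity a (R * S) = 0 := rootMultiplicity_eq_zero (by simp [hRa, hSa])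
    simp [indPoint, indPlus, indMinus, h]
end

section
/- Inversion formula: let P, Q ∈ ℝ[X] and a < b in ℝ, and suppose P and Q have no common zero at a and no common zero at b (i.e. not both P(a) = 0 and Q(a) = 0, and likewise at b). Then Ind_a^b(Q/P) + Ind_a^b(P/Q) = V_a^b(P, Q). -/
open Polynomial

theorem rootMultiplicity_and_unitEval_eq {F G : Polynomial ℝ} {x : ℝ} {m : ℕ}
    (hF : F = (X - C x) ^ m * G) (hG : G.eval x ≠ 0) :
    rootMultiplicity x F = m ∧ unitEval F x = G.eval x := by
  have hG0 : G ≠ 0 := by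
    rintro rfl
    simp at hG
  have hm : rootMultiplicity x F = m := by
    rw [hF, rootMultiplicity_mul
      (mul_ne_zero (pow_ne_zero _ (X_sub_C_ne_zero x)) hG0), rootMultiplicity_X_sub_C_pow,
      rootMultiplicity_eq_zero hG, add_zero]
  refine ⟨hm, ?_⟩
  rw [unitEval, hm, hF, mul_divByMonic_cancel_left _ ((monic_X_sub_C x).pow m)]

theorem exists_eq_X_sub_C_pow_mul {F : Polynomial ℝ} (hF : F ≠ 0) (x : ℝ) :
    ∃ G : Polynomial ℝ, F = (X - C x) ^ rootMultiplicity x F * G ∧ G.eval x ≠ 0 := by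
  obtain ⟨G, h, hG⟩ := exists_eq_pow_rootMultiplicity_mul_and_not_dvd F hF x
  exact ⟨G, h, fun h0 => hG (dvd_iff_isRoot.2 h0)⟩

theorem unitEval_mul {P Q : Polynomial ℝ} (hP : P ≠ 0) (hQ : Q ≠ 0) (x : ℝ) :
    unitEval (P * Q) x = unitEval P x * unitEval Q x := by
  obtain ⟨G, h, hG⟩ := exists_eq_X_sub_C_pow_mul hP x
  obtain ⟨H, k, hH⟩ := exists_eq_X_sub_C_pow_mul hQ x
  have key : P * Q =
      (X - C x) ^ (rootMultiplicity x P + rootMultiplicity x Q) * (G * H) := by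
    conv_lhs => rw [h, k]
    ring
  rw [(rootMultiplicity_and_unitEval_eq key (by simp [hG, hH])).2,
    (rootMultiplicity_and_unitEval_eq h hG).2, (rootMultiplicity_and_unitEval_eq k hH).2, eval_mul]

theorem unitEval_of_eval_ne_zero {F : Polynomial ℝ} {x : ℝ} (h : F.eval x ≠ 0) :
    unitEval F x = F.eval x :=
  (rootMultiplicity_and_unitEval_eq (m := 0) (by simp) h).2

/-- The sign of `F` immediately to the right of `x`. -/
noncomputable def signRight (F : Polynomial ℝ) (x : ℝ) : ℝ := Real.sign (unitEval F x)

/-- The sign of `F` immediately to the left of `x`. -/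
noncomputable def signLeft (F : Polynomial ℝ) (x : ℝ) : ℝ :=
  (-1) ^ rootMultiplicity x F * signRight F x

theorem eval_mul_eval_pos_of_forall_ne_zero {G : Polynomial ℝ} {a b : ℝ} (hab : a ≤ b)
    (h : ∀ x ∈ Set.Icc a b, G.eval x ≠ 0) : 0 < G.eval a * G.eval b := by
  have hc : ContinuousOn (fun x => G.eval x) (Set.Icc a b) := G.continuous.continuousOn
  have ha := h a (Set.left_mem_Icc.2 hab)
  have hb := h b (Set.right_mem_Icc.2 hab)
  by_contra! hle
  rcases lt_or_gt_of_ne ha with ha' | ha'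
  · have hb' : 0 ≤ G.eval b := by
      by_contra! hb'
      nlinarith [mul_pos_of_neg_of_neg ha' hb']
    obtain ⟨x, hx, h0⟩ := intermediate_value_Icc hab hc ⟨ha'.le, hb'⟩
    exact h x hx h0
  · have hb' : G.eval b ≤ 0 := by
      by_contra! hb'
      nlinarith [mul_pos ha' hb']
    obtain ⟨x, hx, h0⟩ := intermediate_value_Icc' hab hc ⟨hb', ha'.le⟩
    exact h x hx h0

theorem Real.sign_mul_of_pos_right (x : ℝ) {y : ℝ} (hy : 0 < y) :
    Real.sign (x * y) = Real.sign x := by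
  rcases lt_trichotomy x 0 with h | h | h
  · rw [Real.sign_of_neg h, Real.sign_of_neg (mul_neg_of_neg_of_pos h hy)]
  · simp [h]
  · rw [Real.sign_of_pos h, Real.sign_of_pos (mul_pos h hy)]

theorem Real.sign_neg_one_pow_mul (n : ℕ) (x : ℝ) :
    Real.sign ((-1) ^ n * x) = (-1) ^ n * Real.sign x := by
  rcases neg_one_pow_eq_or ℝ n with h | h <;> simp [h, Real.sign_neg]

theorem Real.sign_eq_of_mul_pos {x y : ℝ} (h : 0 < x * y) : Real.sign x = Real.sign y := by
  rcases pos_and_pos_or_neg_and_neg_of_mul_pos h with ⟨hx, hy⟩ | ⟨hx, hy⟩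
  · rw [Real.sign_of_pos hx, Real.sign_of_pos hy]
  · rw [Real.sign_of_neg hx, Real.sign_of_neg hy]

theorem signLeft_eq_signRight_of_forall_ne_zero {F : Polynomial ℝ} (hF : F ≠ 0) {a b : ℝ}
    (hab : a < b) (h : ∀ x ∈ Set.Ioo a b, F.eval x ≠ 0) : signLeft F b = signRight F a := by
  obtain ⟨H, hH, hHa⟩ := exists_eq_X_sub_C_pow_mul hF a
  have hH0 : H ≠ 0 := by
    rintro rfl
    simp at hHa
  obtain ⟨G, hG, hGb⟩ := exists_eq_X_sub_C_pow_mul hH0 b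
  generalize rootMultiplicity a F = m at hH
  generalize rootMultiplicity b H = n at hG
  have hba : 0 < b - a := sub_pos.2 hab
  have hHa' : H.eval a = (-1) ^ n * (G.eval a * (b - a) ^ n) := by
    rw [hG]
    simp only [eval_mul, eval_pow, eval_sub, eval_X, eval_C]
    rw [← neg_sub b a, neg_pow]
    ring
  have hFb : F = (X - C b) ^ n * ((X - C a) ^ m * G) := by
    rw [hH, hG]
    ring
  have hb := rootMultiplicity_and_unitEval_eq hFb
    (by simpa using ⟨fun h0 => absurd h0 hba.ne', hGb⟩)
  have hpos : 0 < G.eval a * G.eval b := by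
    refine eval_mul_eval_pos_of_forall_ne_zero hab.le fun x hx h0 => ?_
    rcases eq_or_lt_of_le hx.1 with rfl | hxa
    · exact hHa (by rw [hHa', h0]; simp)
    rcases eq_or_lt_of_le hx.2 with rfl | hxb
    · exact hGb h0
    · exact h x ⟨hxa, hxb⟩ (by rw [hFb]; simp [h0])
  rw [signLeft, signRight, signRight, hb.1, hb.2, (rootMultiplicity_and_unitEval_eq hH hHa).2,
    hHa', Real.sign_neg_one_pow_mul, Real.sign_mul_of_pos_right _ (pow_pos hba n)]
  simp only [eval_mul, eval_pow, eval_sub, eval_X, eval_C]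
  rw [mul_comm ((b - a) ^ m), Real.sign_mul_of_pos_right _ (pow_pos hba m),
    Real.sign_eq_of_mul_pos hpos]

theorem sum_signRight_sub_signLeft {F : Polynomial ℝ} (hF : F ≠ 0) {a b : ℝ} (hab : a < b) :
    ∑ x ∈ F.roots.toFinset with a < x ∧ x < b, (signRight F x - signLeft F x) =
      signLeft F b - signRight F a := by
  classical
  induction hn : (F.roots.toFinset.filter fun x => a < x ∧ x < b).card
    using Nat.strong_induction_on generalizing a b with
  | _ n ih =>
    subst hn
    by_cases h : ∀ x ∈ Set.Ioo a b, F.eval x ≠ 0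
    · rw [signLeft_eq_signRight_of_forall_ne_zero hF hab h, sub_self]
      refine Finset.sum_eq_zero fun x hx => ?_
      simp only [Finset.mem_filter, Multiset.mem_toFinset, mem_roots hF] at hx
      exact absurd hx.1 (h x hx.2)
    · push Not at h
      obtain ⟨c, ⟨hac, hcb⟩, hc⟩ := h
      have hcr : c ∈ F.roots.toFinset := by simp [hF, hc]
      have h₁ := ih _ (Finset.card_lt_card (Finset.ssubset_iff_of_subset (by
        intro x; simp only [Finset.mem_filter]; grind) |>.2
          ⟨c, by simp only [Finset.mem_filter]; grind, by simp⟩)) hac rfl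
      have h₂ := ih _ (Finset.card_lt_card (Finset.ssubset_iff_of_subset (by
        intro x; simp only [Finset.mem_filter]; grind) |>.2
          ⟨c, by simp only [Finset.mem_filter]; grind, by simp⟩)) hcb rfl
      have hsplit : (F.roots.toFinset.filter fun x => a < x ∧ x < b) =
          insert c ((F.roots.toFinset.filter fun x => a < x ∧ x < c) ∪
            F.roots.toFinset.filter fun x => c < x ∧ x < b) := by
        ext x
        simp only [Finset.mem_filter, Finset.mem_insert, Finset.mem_union]
        grind
      rw [hsplit, Finset.sum_insert (by simp), Finset.sum_union, h₁, h₂]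
      · ring
      · rw [Finset.disjoint_left]
        intro x
        simp only [Finset.mem_filter]
        grind

theorem neg_one_pow_sub_eq_neg_one_pow_add {m n : ℕ} (h : n ≤ m) :
    (-1 : ℝ) ^ (m - n) = (-1) ^ (m + n) := by
  obtain ⟨k, rfl⟩ := Nat.exists_eq_add_of_le h
  rw [Nat.add_sub_cancel_left, add_right_comm, pow_add _ (n + n),
    Even.neg_one_pow ⟨n, rfl⟩, one_mul]

theorem indPlus_add_indPlus {P Q : Polynomial ℝ} (hP : P ≠ 0) (hQ : Q ≠ 0) (x : ℝ) :
    indPlus Q P x + indPlus P Q x =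
      if rootMultiplicity x P = rootMultiplicity x Q then 0
      else 1 / 2 * signRight (P * Q) x := by
  rw [indPlus, indPlus, signRight, unitEval_mul hP hQ, mul_comm (unitEval Q x)]
  rcases lt_trichotomy (rootMultiplicity x P) (rootMultiplicity x Q) with h | h | h
  · simp [h, h.le, h.ne]
  · simp [h]
  · simp [h, h.le, h.ne']

theorem indMinus_add_indMinus {P Q : Polynomial ℝ} (hP : P ≠ 0) (hQ : Q ≠ 0) (x : ℝ) :
    indMinus Q P x + indMinus P Q x =
      if rootMultiplicity x P = rootMultiplicity x Q then 0
      else 1 / 2 * signLeft (P * Q) x := by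
  rw [indMinus, indMinus, signLeft, signRight, unitEval_mul hP hQ, mul_comm (unitEval Q x),
    rootMultiplicity_mul (mul_ne_zero hP hQ)]
  rcases lt_trichotomy (rootMultiplicity x P) (rootMultiplicity x Q) with h | h | h
  · simp [h, h.le, h.ne, neg_one_pow_sub_eq_neg_one_pow_add h.le, mul_assoc,
      add_comm (rootMultiplicity x Q)]
  · simp [h]
  · simp [h, h.le, h.ne', neg_one_pow_sub_eq_neg_one_pow_add h.le, mul_assoc]

theorem indPoint_add_indPoint {P Q : Polynomial ℝ} (hP : P ≠ 0) (hQ : Q ≠ 0) (x : ℝ) :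
    indPoint Q P x + indPoint P Q x =
      1 / 2 * (signRight (P * Q) x - signLeft (P * Q) x) := by
  have h₁ := indPlus_add_indPlus hP hQ x
  have h₂ := indMinus_add_indMinus hP hQ x
  simp only [indPoint]
  split_ifs at h₁ h₂ with h
  · have : signLeft (P * Q) x = signRight (P * Q) x := by
      rw [signLeft, rootMultiplicity_mul (mul_ne_zero hP hQ), h, Even.neg_one_pow ⟨_, rfl⟩,
        one_mul]
    linarith
  · linarith

theorem indPoint_eq_zero_of_eval_ne_zero (R : Polynomial ℝ) {S : Polynomial ℝ} {x : ℝ}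
    (h : S.eval x ≠ 0) : indPoint R S x = 0 := by
  simp [indPoint, indPlus, indMinus, rootMultiplicity_eq_zero h]

theorem sum_indPoint_of_dvd (R : Polynomial ℝ) {S F : Polynomial ℝ} (hF : F ≠ 0) (hSF : S ∣ F)
    (a b : ℝ) :
    (∑ x ∈ S.roots.toFinset, if a < x ∧ x < b then indPoint R S x else 0) =
      ∑ x ∈ F.roots.toFinset with a < x ∧ x < b, indPoint R S x := by
  have hS : S ≠ 0 := ne_zero_of_dvd_ne_zero hF hSF
  rw [Finset.sum_filter]
  refine Finset.sum_subset ?_ fun x _ hx => ?_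
  · exact Multiset.toFinset_subset.2 (Multiset.subset_of_le (roots.le_of_dvd hF hSF))
  · have hx' : S.eval x ≠ 0 := by simpa [hS] using hx
    simp [indPoint_eq_zero_of_eval_ne_zero R hx']

theorem signVarAt_pair (P Q : Polynomial ℝ) (x : ℝ) :
    signVarAt [P, Q] x = 1 / 2 * |Real.sign (P.eval x) - Real.sign (Q.eval x)| := by
  simp [signVarAt, signVar]

theorem abs_sign_sub_sign_eq_one_sub_sign_mul {x y : ℝ} (hx : x ≠ 0) (hy : y ≠ 0) :
    |Real.sign x - Real.sign y| = 1 - Real.sign (x * y) := by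
  rcases lt_or_gt_of_ne hx with hx | hx <;> rcases lt_or_gt_of_ne hy with hy | hy
  · simp [Real.sign_of_neg hx, Real.sign_of_neg hy, Real.sign_of_pos (mul_pos_of_neg_of_neg hx hy)]
  · rw [Real.sign_of_neg hx, Real.sign_of_pos hy, Real.sign_of_neg (mul_neg_of_neg_of_pos hx hy)]
    norm_num
  · rw [Real.sign_of_pos hx, Real.sign_of_neg hy, Real.sign_of_neg (mul_neg_of_pos_of_neg hx hy)]
    norm_num
  · simp [Real.sign_of_pos hx, Real.sign_of_pos hy, Real.sign_of_pos (mul_pos hx hy)]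

theorem abs_sign_eq_one {x : ℝ} (hx : x ≠ 0) : |Real.sign x| = 1 := by
  rcases Real.sign_apply_eq_of_ne_zero x hx with h | h <;> simp [h]

theorem signVarAt_pair_eq {P Q : Polynomial ℝ} (hP : P ≠ 0) (hQ : Q ≠ 0) {x : ℝ}
    (hx : ¬(P.eval x = 0 ∧ Q.eval x = 0)) :
    signVarAt [P, Q] x =
      if rootMultiplicity x P = rootMultiplicity x Q then 1 / 2 * (1 - signRight (P * Q) x)
      else 1 / 2 := by
  rw [signVarAt_pair]
  by_cases hPx : P.eval x = 0
  · have hQx : Q.eval x ≠ 0 := fun h => hx ⟨hPx, h⟩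
    have hne : rootMultiplicity x P ≠ 0 := ((rootMultiplicity_pos hP).2 hPx).ne'
    simp [rootMultiplicity_eq_zero hQx, hne, hPx, abs_sign_eq_one hQx]
  · by_cases hQx : Q.eval x = 0
    · have hne : rootMultiplicity x Q ≠ 0 := ((rootMultiplicity_pos hQ).2 hQx).ne'
      simp [rootMultiplicity_eq_zero hPx, hne.symm, hQx, abs_sign_eq_one hPx]
    · rw [if_pos (by rw [rootMultiplicity_eq_zero hPx, rootMultiplicity_eq_zero hQx]),
        abs_sign_sub_sign_eq_one_sub_sign_mul hPx hQx, signRight,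
        unitEval_of_eval_ne_zero (by simp [hPx, hQx]), eval_mul]

theorem signVarAt_pair_eq_indPlus {P Q : Polynomial ℝ} (hP : P ≠ 0) (hQ : Q ≠ 0) {x : ℝ}
    (hx : ¬(P.eval x = 0 ∧ Q.eval x = 0)) :
    signVarAt [P, Q] x =
      1 / 2 * (1 - signRight (P * Q) x) + (indPlus Q P x + indPlus P Q x) := by
  rw [signVarAt_pair_eq hP hQ hx, indPlus_add_indPlus hP hQ]
  split_ifs <;> ring

theorem signVarAt_pair_eq_indMinus {P Q : Polynomial ℝ} (hP : P ≠ 0) (hQ : Q ≠ 0) {x : ℝ}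
    (hx : ¬(P.eval x = 0 ∧ Q.eval x = 0)) :
    signVarAt [P, Q] x =
      1 / 2 * (1 - signLeft (P * Q) x) + (indMinus Q P x + indMinus P Q x) := by
  rw [signVarAt_pair_eq hP hQ hx, indMinus_add_indMinus hP hQ]
  split_ifs with h
  · rw [signLeft, rootMultiplicity_mul (mul_ne_zero hP hQ), h, Even.neg_one_pow ⟨_, rfl⟩]
    ring
  · ring

/-- Inversion formula: if `P` and `Q` have no common zero at `a` nor at `b`, then
`Ind_a^b(Q/P) + Ind_a^b(P/Q) = V_a^b(P, Q)`. -/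
theorem cauchyIndex_inversion (P Q : Polynomial ℝ) (a b : ℝ) (hab : a < b)
    (ha : ¬(P.eval a = 0 ∧ Q.eval a = 0)) (hb : ¬(P.eval b = 0 ∧ Q.eval b = 0)) :
    cauchyIndex Q P a b + cauchyIndex P Q a b =
      signVarAt [P, Q] a - signVarAt [P, Q] b := by
  by_cases hP : P = 0
  · subst hP
    simp only [eval_zero, true_and] at ha hb
    simp [cauchyIndex, signVarAt_pair, abs_sign_eq_one ha, abs_sign_eq_one hb]
  by_cases hQ : Q = 0
  · subst hQ
    simp only [eval_zero, and_true] at ha hb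
    simp [cauchyIndex, signVarAt_pair, abs_sign_eq_one ha, abs_sign_eq_one hb]
  have hF : P * Q ≠ 0 := mul_ne_zero hP hQ
  have hsum : (∑ x ∈ P.roots.toFinset, if a < x ∧ x < b then indPoint Q P x else 0) +
      (∑ x ∈ Q.roots.toFinset, if a < x ∧ x < b then indPoint P Q x else 0) =
      1 / 2 * (signLeft (P * Q) b - signRight (P * Q) a) := by
    rw [sum_indPoint_of_dvd Q hF (dvd_mul_right P Q), sum_indPoint_of_dvd P hF (dvd_mul_left Q P),
      ← Finset.sum_add_distrib, ← sum_signRight_sub_signLeft hF hab, Finset.mul_sum]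
    exact Finset.sum_congr rfl fun x _ => indPoint_add_indPoint hP hQ x
  rw [cauchyIndex, cauchyIndex, if_neg (by simp [hP, hQ]), if_neg (by simp [hP, hQ]),
    signVarAt_pair_eq_indPlus hP hQ ha, signVarAt_pair_eq_indMinus hP hQ hb]
  linarith
end

section
/- Let n ≥ 2, let (S_0,…,S_n) be polynomials in ℝ[X] and [a,b] ⊂ ℝ an interval with a < b, and suppose there are polynomials A_k, B_k, C_k ∈ ℝ[X] (for 0 < k < n) with A_k·S_{k+1} + B_k·S_k + C_k·S_{k−1} = 0, such that whenever S_k(x) = 0 for some 0 < k < n and x ∈ [a,b] we have A_k(x) ≠ 0 and A_k(x)·C_k(x) ≥ 0. Then (S_0,…,S_n) is a Sturm chain on [a,b] if and only if S_{n−1} and S_n have no common zero in [a,b]. In particular, (S_0,…,S_n) is a Sturm chain on [a,b] if S_n has no zero in [a,b]. -/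
open Polynomial

/-- `(S 0, …, S n)` is a Sturm chain on `[a, b]`: for `n ≥ 2`, whenever `S k` vanishes at
some `x ∈ [a,b]` with `0 < k < n`, its neighbours have opposite signs there; for `n = 1`
the condition is that `S 0` and `S 1` have no common zero in `[a, b]`. -/
def IsSturmChain (S : ℕ → Polynomial ℝ) (n : ℕ) (a b : ℝ) : Prop :=
  (∀ k, 0 < k → k < n → ∀ x ∈ Set.Icc a b, (S k).eval x = 0 →
      (S (k - 1)).eval x * (S (k + 1)).eval x < 0) ∧
  (n = 1 → ∀ x ∈ Set.Icc a b, ¬((S 0).eval x = 0 ∧ (S 1).eval x = 0))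

/-- In a three-term relation with nonvanishing leading coefficients at the zeros, a common zero
of two consecutive terms propagates to the terminal pair. -/
theorem eval_eq_zero_of_consecutive_of_three_term_relation
    {n : ℕ} {S A B C : ℕ → Polynomial ℝ} {x : ℝ}
    (hrel : ∀ k, 0 < k → k < n → A k * S (k + 1) + B k * S k + C k * S (k - 1) = 0)
    (hA : ∀ k, 0 < k → k < n → (S k).eval x = 0 → (A k).eval x ≠ 0)
    {k : ℕ} (hkn : k < n) (hk : (S k).eval x = 0) (hk1 : (S (k + 1)).eval x = 0) :
    (S (n - 1)).eval x = 0 ∧ (S n).eval x = 0 := by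
  suffices h : ∀ m, k ≤ m → m < n → (S m).eval x = 0 ∧ (S (m + 1)).eval x = 0 by
    have := h (n - 1) (by omega) (by omega)
    rwa [Nat.sub_add_cancel (by omega)] at this
  intro m hm
  induction m, hm using Nat.le_induction with
  | base => exact fun _ => ⟨hk, hk1⟩
  | succ m hm ih =>
    intro hmn
    obtain ⟨h0, h1⟩ := ih (by omega)
    have h := congrArg (eval x) (hrel (m + 1) m.succ_pos hmn)
    simp only [eval_add, eval_mul, eval_zero, Nat.add_sub_cancel, h0, h1, mul_zero,
      add_zero] at h
    exact ⟨h1, (mul_eq_zero.mp h).resolve_left (hA (m + 1) m.succ_pos hmn h1)⟩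

/-- Algebraic criterion for Sturm chains: given a three-term relation
`A k · S (k+1) + B k · S k + C k · S (k-1) = 0` for `0 < k < n` such that at every zero
`x ∈ [a,b]` of `S k` one has `A k (x) ≠ 0` and `A k (x) · C k (x) ≥ 0`, the sequence
`(S 0, …, S n)` is a Sturm chain on `[a, b]` if and only if the terminal pair
`(S (n-1), S n)` has no common zero in `[a, b]`; in particular it is a Sturm chain
if `S n` has no zero in `[a, b]`. -/
theorem isSturmChain_iff_of_three_term_relation
    (n : ℕ) (hn : 2 ≤ n) (S A B C : ℕ → Polynomial ℝ) (a b : ℝ) (hab : a < b)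
    (hrel : ∀ k, 0 < k → k < n → A k * S (k + 1) + B k * S k + C k * S (k - 1) = 0)
    (hsign : ∀ k, 0 < k → k < n → ∀ x ∈ Set.Icc a b, (S k).eval x = 0 →
      (A k).eval x ≠ 0 ∧ 0 ≤ (A k).eval x * (C k).eval x) :
    (IsSturmChain S n a b ↔
      ∀ x ∈ Set.Icc a b, ¬((S (n - 1)).eval x = 0 ∧ (S n).eval x = 0)) ∧
    ((∀ x ∈ Set.Icc a b, (S n).eval x ≠ 0) → IsSturmChain S n a b) := by
  have main : (∀ x ∈ Set.Icc a b, ¬((S (n - 1)).eval x = 0 ∧ (S n).eval x = 0)) →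
      IsSturmChain S n a b := by
    refine fun hend => ⟨fun k hk0 hkn x hx hk => ?_, fun h => by omega⟩
    have hne : (S (k + 1)).eval x ≠ 0 := fun hk1 => hend x hx <|
      eval_eq_zero_of_consecutive_of_three_term_relation hrel
        (fun j hj0 hjn hj => (hsign j hj0 hjn x hx hj).1) hkn hk hk1
    obtain ⟨hA, hAC⟩ := hsign k hk0 hkn x hx hk
    have h := congrArg (eval x) (hrel k hk0 hkn)
    simp only [eval_add, eval_mul, eval_zero, hk, mul_zero, add_zero] at h
    have hne' : (S (k - 1)).eval x ≠ 0 := fun h0 => by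
      rw [h0, mul_zero, add_zero] at h
      exact mul_ne_zero hA hne h
    refine lt_of_le_of_ne ?_ (mul_ne_zero hne' hne)
    have hA2 : 0 < (A k).eval x ^ 2 := by positivity
    have hmul : (A k).eval x ^ 2 * ((S (k - 1)).eval x * (S (k + 1)).eval x) =
        -((A k).eval x * (C k).eval x * (S (k - 1)).eval x ^ 2) := by
      linear_combination (A k).eval x * (S (k - 1)).eval x * h
    refine nonpos_of_mul_nonpos_right ?_ hA2
    rw [hmul]
    exact neg_nonpos.mpr (mul_nonneg hAC (sq_nonneg _))
  refine ⟨⟨fun hS x hx h => ?_, main⟩, fun h => main fun x hx h' => h x hx h'.2⟩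
  have hlt := hS.1 (n - 1) (by omega) (by omega) x hx h.1
  rw [Nat.sub_add_cancel (by omega : 1 ≤ n), h.2, mul_zero] at hlt
  exact lt_irrefl _ hlt
end

section
/- Let P ∈ ℝ[X] be a nonzero polynomial and a < b in ℝ. Then #{x ∈ (a,b) : P(x) = 0} + ½·#{x ∈ {a,b} : P(x) = 0} = Ind_a^b(P'/P), where P' denotes the derivative of P; i.e. the Cauchy index of P'/P on [a,b] counts the roots of P in [a,b] without multiplicity, roots at the endpoints counting one half. -/
open Polynomial

/-- At a root of multiplicity `m`, the unit part of `P'` takes `m` times the value of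
the unit part of `P`. -/
theorem unitEval_derivative {P : Polynomial ℝ} {x : ℝ} (hP : P ≠ 0) (hx : P.eval x = 0) :
    unitEval P.derivative x = rootMultiplicity x P * unitEval P x := by
  obtain ⟨n, hn⟩ : ∃ n, rootMultiplicity x P = n + 1 :=
    Nat.exists_eq_succ_of_ne_zero ((rootMultiplicity_pos hP).2 hx).ne'
  have hn' : rootMultiplicity x P.derivative = n := by
    rw [derivative_rootMultiplicity_of_root hx, hn, Nat.add_sub_cancel]
  have h₁ : ((derivative^[n + 1] P).eval x) = (n + 1).factorial • unitEval P x := by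
    rw [← hn]
    exact eval_iterate_derivative_rootMultiplicity
  have h₂ : ((derivative^[n] P.derivative).eval x) = n.factorial • unitEval P.derivative x := by
    rw [← hn']
    exact eval_iterate_derivative_rootMultiplicity
  rw [Function.iterate_succ_apply, h₂, Nat.factorial_succ, nsmul_eq_mul, nsmul_eq_mul] at h₁
  have hfac : (n.factorial : ℝ) ≠ 0 := Nat.cast_ne_zero.2 n.factorial_ne_zero
  refine mul_left_cancel₀ hfac ?_
  rw [h₁, hn]
  push_cast
  ring

theorem unitEval_derivative_mul_pos {P : Polynomial ℝ} {x : ℝ} (hP : P ≠ 0)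
    (hx : P.eval x = 0) : 0 < unitEval P.derivative x * unitEval P x := by
  have hm : (0 : ℝ) < rootMultiplicity x P := Nat.cast_pos.2 ((rootMultiplicity_pos hP).2 hx)
  have hu : unitEval P x ≠ 0 := eval_divByMonic_pow_rootMultiplicity_ne_zero x hP
  rw [unitEval_derivative hP hx, mul_assoc]
  exact mul_pos hm (mul_self_pos.2 hu)

theorem indPlus_derivative {P : Polynomial ℝ} (hP : P ≠ 0) (x : ℝ) :
    indPlus P.derivative P x = if P.eval x = 0 then 1 / 2 else 0 := by
  unfold indPlus
  split_ifs with h hx hx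
  · rw [Real.sign_of_pos (unitEval_derivative_mul_pos hP hx), mul_one]
  · rw [rootMultiplicity_eq_zero hx] at h
    omega
  · have := (rootMultiplicity_pos hP).2 hx
    rw [derivative_rootMultiplicity_of_root hx] at h
    omega
  · rfl

theorem indMinus_derivative {P : Polynomial ℝ} (hP : P ≠ 0) (x : ℝ) :
    indMinus P.derivative P x = if P.eval x = 0 then -(1 / 2) else 0 := by
  unfold indMinus
  split_ifs with h hx hx
  · have hm := (rootMultiplicity_pos hP).2 hx
    have hsub : rootMultiplicity x P - rootMultiplicity x P.derivative = 1 := by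
      rw [derivative_rootMultiplicity_of_root hx]
      omega
    rw [Real.sign_of_pos (unitEval_derivative_mul_pos hP hx), hsub]
    norm_num
  · rw [rootMultiplicity_eq_zero hx] at h
    omega
  · have := (rootMultiplicity_pos hP).2 hx
    rw [derivative_rootMultiplicity_of_root hx] at h
    omega
  · rfl

theorem indPoint_derivative {P : Polynomial ℝ} (hP : P ≠ 0) {x : ℝ} (hx : P.eval x = 0) :
    indPoint P.derivative P x = 1 := by
  rw [indPoint, indPlus_derivative hP, indMinus_derivative hP, if_pos hx, if_pos hx]
  norm_num

/-- The Cauchy index of `P'/P` on `[a, b]` counts the roots of the nonzero polynomial `P`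
in `[a, b]` without multiplicity, roots at the endpoints counting one half. -/
theorem cauchyIndex_deriv_count (P : Polynomial ℝ) (hP : P ≠ 0) (a b : ℝ) (hab : a < b) :
    ((P.roots.toFinset.filter fun x => a < x ∧ x < b).card : ℝ) +
      (1 / 2) * ((if P.eval a = 0 then (1 : ℝ) else 0) + (if P.eval b = 0 then (1 : ℝ) else 0)) =
    cauchyIndex P.derivative P a b := by
  by_cases hd : P.derivative = 0
  · obtain ⟨c, rfl⟩ : ∃ c, P = C c := ⟨_, eq_C_of_derivative_eq_zero hd⟩
    have hc : c ≠ 0 := C_ne_zero.1 hP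
    simp [cauchyIndex, hc]
  · have hsum : (∑ x ∈ P.roots.toFinset,
          if a < x ∧ x < b then indPoint P.derivative P x else 0) =
        ((P.roots.toFinset.filter fun x => a < x ∧ x < b).card : ℝ) := by
      rw [Finset.card_filter, Nat.cast_sum]
      refine Finset.sum_congr rfl fun x hx => ?_
      rw [Multiset.mem_toFinset, mem_roots hP] at hx
      rw [indPoint_derivative hP hx]
      push_cast
      rfl
    rw [cauchyIndex, if_neg (not_or.2 ⟨hd, hP⟩), hsum, indPlus_derivative hP,
      indMinus_derivative hP]
    split_ifs <;> ring
end

section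
/- Let F ∈ ℂ[X,Y] be a polynomial in two real variables and (x,y) ∈ ℝ² with F(x,y) ≠ 0. Then there exists δ > 0 such that ind_{∂Γ}(F) = 0 for every rectangle Γ ⊆ [x−δ, x+δ] × [y−δ, y+δ]. -/
open Polynomial

/-- Real part of a complex polynomial, coefficientwise. -/
noncomputable def rePoly (p : Polynomial ℂ) : Polynomial ℝ :=
  p.sum fun n c => Polynomial.C c.re * Polynomial.X ^ n

/-- Imaginary part of a complex polynomial, coefficientwise. -/
noncomputable def imPoly (p : Polynomial ℂ) : Polynomial ℝ :=
  p.sum fun n c => Polynomial.C c.im * Polynomial.X ^ n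

/-- For `F ∈ ℂ[X,Y]` (two real variables, identifying `ℂ` with `ℝ²`), the one-variable
polynomial `F̂ ∈ ℂ[T]` obtained by substituting the affine parametrization
`t ↦ a + t(b - a)` of the segment from `a` to `b`, i.e.
`X ↦ re a + t(re b - re a)` and `Y ↦ im a + t(im b - im a)`. -/
noncomputable def segPolyXY (F : MvPolynomial (Fin 2) ℂ) (a b : ℂ) : Polynomial ℂ :=
  MvPolynomial.aeval (fun j : Fin 2 =>
    if j = 0 then Polynomial.C (a.re : ℂ) + Polynomial.C ((b.re - a.re : ℝ) : ℂ) * Polynomial.X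
    else Polynomial.C (a.im : ℂ) + Polynomial.C ((b.im - a.im : ℝ) : ℂ) * Polynomial.X) F

/-- The index `ind_{[a,b]}(F) = ½ · Ind_0^1(re F̂ / im F̂)` of `F ∈ ℂ[X,Y]` along the
segment from `a` to `b`. -/
noncomputable def segIndexXY (F : MvPolynomial (Fin 2) ℂ) (a b : ℂ) : ℝ :=
  (1 / 2) * cauchyIndex (rePoly (segPolyXY F a b)) (imPoly (segPolyXY F a b)) 0 1

/-- The algebraic index `ind_{∂Γ}(F)` of `F ∈ ℂ[X,Y]` along the positively oriented
boundary of the rectangle `Γ = [x₀,x₁] × [y₀,y₁] ⊂ ℂ`. -/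
noncomputable def rectIndexXY (F : MvPolynomial (Fin 2) ℂ) (x₀ x₁ y₀ y₁ : ℝ) : ℝ :=
  segIndexXY F (x₀ + y₀ * Complex.I) (x₁ + y₀ * Complex.I) +
  segIndexXY F (x₁ + y₀ * Complex.I) (x₁ + y₁ * Complex.I) +
  segIndexXY F (x₁ + y₁ * Complex.I) (x₀ + y₁ * Complex.I) +
  segIndexXY F (x₀ + y₁ * Complex.I) (x₀ + y₀ * Complex.I)

/-- Evaluation of `F ∈ ℂ[X,Y]` at a point `(x, y) ∈ ℝ²`. -/
noncomputable def evalXY (F : MvPolynomial (Fin 2) ℂ) (x y : ℝ) : ℂ :=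
  MvPolynomial.eval (fun j : Fin 2 => if j = 0 then (x : ℂ) else (y : ℂ)) F

open Filter Topology

theorem real_sign_mul (a b : ℝ) : Real.sign (a * b) = Real.sign a * Real.sign b := by
  rcases lt_trichotomy a 0 with ha | rfl | ha <;> rcases lt_trichotomy b 0 with hb | rfl | hb <;>
    simp [Real.sign_of_neg, Real.sign_of_pos, mul_pos_of_neg_of_neg, mul_neg_of_neg_of_pos,
      mul_neg_of_pos_of_neg, *]

theorem real_sign_pow (a : ℝ) (n : ℕ) : Real.sign (a ^ n) = Real.sign a ^ n := by
  induction n with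
  | zero => simp
  | succ n ih => rw [pow_succ, real_sign_mul, ih, pow_succ]

/-- A continuous real function has locally constant sign around a point where it is nonzero. -/
theorem eventually_sign_eq {α : Type*} [TopologicalSpace α] {f : α → ℝ} {x : α}
    (hf : ContinuousAt f x) (hx : f x ≠ 0) :
    ∀ᶠ t in 𝓝 x, Real.sign (f t) = Real.sign (f x) := by
  rcases lt_or_gt_of_ne hx with h | h
  · filter_upwards [hf.eventually_lt_const h] with t ht
    rw [Real.sign_of_neg h, Real.sign_of_neg ht]
  · filter_upwards [hf.eventually_const_lt h] with t ht
    rw [Real.sign_of_pos h, Real.sign_of_pos ht]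

theorem eval_eq_pow_mul_eval_divByMonic (P : ℝ[X]) (x t : ℝ) :
    P.eval t = (t - x) ^ rootMultiplicity x P *
      (P /ₘ (X - C x) ^ rootMultiplicity x P).eval t := by
  conv_lhs => rw [← pow_mul_divByMonic_rootMultiplicity_eq P x]
  simp

theorem unitEval_ne_zero {P : ℝ[X]} (hP : P ≠ 0) (x : ℝ) : unitEval P x ≠ 0 :=
  eval_divByMonic_pow_rootMultiplicity_ne_zero x hP

theorem unitEval_of_eval_ne_zero_s11 {P : ℝ[X]} {x : ℝ} (hx : P.eval x ≠ 0) :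
    unitEval P x = P.eval x := by
  rw [unitEval, rootMultiplicity_eq_zero hx]
  simp

/-- The sign of `P` immediately to the right of `x`. -/
noncomputable def rightSign (P : ℝ[X]) (x : ℝ) : ℝ :=
  Real.sign (unitEval P x)

/-- The sign of `P` immediately to the left of `x`. -/
noncomputable def leftSign (P : ℝ[X]) (x : ℝ) : ℝ :=
  (-1) ^ rootMultiplicity x P * Real.sign (unitEval P x)

theorem eventually_sign_eq_rightSign {P : ℝ[X]} (hP : P ≠ 0) (x : ℝ) :
    ∀ᶠ t in 𝓝[>] x, Real.sign (P.eval t) = rightSign P x := by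
  have h := eventually_sign_eq
    (Polynomial.continuous (P /ₘ (X - C x) ^ rootMultiplicity x P)).continuousAt
    (unitEval_ne_zero hP x)
  filter_upwards [h.filter_mono nhdsWithin_le_nhds, self_mem_nhdsWithin] with t ht hxt
  rw [eval_eq_pow_mul_eval_divByMonic P x t, real_sign_mul, ht, real_sign_pow,
    Real.sign_of_pos (sub_pos.2 hxt), one_pow, one_mul]
  rfl

theorem eventually_sign_eq_leftSign {P : ℝ[X]} (hP : P ≠ 0) (x : ℝ) :
    ∀ᶠ t in 𝓝[<] x, Real.sign (P.eval t) = leftSign P x := by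
  have h := eventually_sign_eq
    (Polynomial.continuous (P /ₘ (X - C x) ^ rootMultiplicity x P)).continuousAt
    (unitEval_ne_zero hP x)
  filter_upwards [h.filter_mono nhdsWithin_le_nhds, self_mem_nhdsWithin] with t ht hxt
  rw [eval_eq_pow_mul_eval_divByMonic P x t, real_sign_mul, ht, real_sign_pow,
    Real.sign_of_neg (sub_neg.2 hxt)]
  rfl

theorem sign_eval_eq_of_no_roots {P : ℝ[X]} {a b : ℝ}
    (h : ∀ t ∈ Set.Ioo a b, P.eval t ≠ 0) {s t : ℝ} (hs : s ∈ Set.Ioo a b)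
    (ht : t ∈ Set.Ioo a b) : Real.sign (P.eval s) = Real.sign (P.eval t) := by
  have hc : ContinuousOn (fun t => P.eval t) (Set.Ioo a b) := P.continuous.continuousOn
  rcases lt_or_gt_of_ne (h s hs) with h₁ | h₁ <;> rcases lt_or_gt_of_ne (h t ht) with h₂ | h₂
  · rw [Real.sign_of_neg h₁, Real.sign_of_neg h₂]
  · obtain ⟨c, hc, h0⟩ := isPreconnected_Ioo.intermediate_value hs ht hc ⟨h₁.le, h₂.le⟩
    exact absurd h0 (h c hc)
  · obtain ⟨c, hc, h0⟩ := isPreconnected_Ioo.intermediate_value ht hs hc ⟨h₂.le, h₁.le⟩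
    exact absurd h0 (h c hc)
  · rw [Real.sign_of_pos h₁, Real.sign_of_pos h₂]

theorem rightSign_eq_leftSign_of_no_roots {P : ℝ[X]} (hP : P ≠ 0) {a b : ℝ} (hab : a < b)
    (h : ∀ t ∈ Set.Ioo a b, P.eval t ≠ 0) : rightSign P a = leftSign P b := by
  obtain ⟨s, hs, hsI⟩ :=
    ((eventually_sign_eq_rightSign hP a).and (Ioo_mem_nhdsGT hab)).exists
  obtain ⟨t, ht, htI⟩ :=
    ((eventually_sign_eq_leftSign hP b).and (Ioo_mem_nhdsLT hab)).exists
  rw [← hs, ← ht, sign_eval_eq_of_no_roots h hsI htI]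

theorem sum_ite_Ioo_split {T : Finset ℝ} (f : ℝ → ℝ) {a b c : ℝ} (hc : c ∈ T) (hac : a < c)
    (hcb : c < b) :
    (∑ x ∈ T, if a < x ∧ x < b then f x else 0) =
      (∑ x ∈ T, if a < x ∧ x < c then f x else 0) + f c +
        ∑ x ∈ T, if c < x ∧ x < b then f x else 0 := by
  have hfc : f c = ∑ x ∈ T, if x = c then f x else 0 := by simp [hc]
  rw [hfc, ← Finset.sum_add_distrib, ← Finset.sum_add_distrib]
  refine Finset.sum_congr rfl fun x _ => ?_
  rcases lt_trichotomy x c with h | rfl | h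
  · simp [h, h.ne, h.not_gt, h.trans hcb]
  · simp [hac, hcb]
  · simp [h, h.ne', h.not_gt, hac.trans h]

/-- The sign of `P` just left of `b` is its sign just right of `a` plus the jumps in between. -/
theorem rightSign_add_sum_sub_leftSign {P : ℝ[X]} (hP : P ≠ 0) {a b : ℝ} (hab : a < b) :
    rightSign P a + (∑ x ∈ P.roots.toFinset,
      if a < x ∧ x < b then rightSign P x - leftSign P x else 0) - leftSign P b = 0 := by
  induction hn : (P.roots.toFinset.filter fun x => a < x ∧ x < b).card
    using Nat.strong_induction_on generalizing a b with
  | _ n ih =>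
  by_cases h : ∃ c ∈ P.roots.toFinset, a < c ∧ c < b
  · obtain ⟨c, hc, hac, hcb⟩ := h
    have hmem : c ∈ P.roots.toFinset.filter fun x => a < x ∧ x < b := by
      simp only [Finset.mem_filter]; exact ⟨hc, hac, hcb⟩
    have h₁ := ih _ (by
      rw [← hn]
      refine Finset.card_lt_card (Finset.ssubset_iff_of_subset ?_ |>.2 ⟨c, hmem, by simp⟩)
      exact Finset.monotone_filter_right _ fun x _ hx => ⟨hx.1, hx.2.trans hcb⟩) hac rfl
    have h₂ := ih _ (by
      rw [← hn]
      refine Finset.card_lt_card (Finset.ssubset_iff_of_subset ?_ |>.2 ⟨c, hmem, by simp⟩)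
      exact Finset.monotone_filter_right _ fun x _ hx => ⟨hac.trans hx.1, hx.2⟩) hcb rfl
    rw [sum_ite_Ioo_split _ hc hac hcb]
    linarith
  · push Not at h
    rw [Finset.sum_eq_zero fun x hx => if_neg fun hx' => (h x hx hx'.1).not_gt hx'.2,
      rightSign_eq_leftSign_of_no_roots hP hab fun t ht h0 =>
        (h t (by simp [hP, h0]) ht.1).not_gt ht.2]
    ring

theorem indPlus_of_eval_ne_zero {R S : ℝ[X]} (hS : S ≠ 0) {x : ℝ} (hx : R.eval x ≠ 0) :
    indPlus R S x =
      1 / 2 * Real.sign (R.eval x) * (rightSign S x - Real.sign (S.eval x)) := by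
  rw [indPlus, rootMultiplicity_eq_zero hx, unitEval_of_eval_ne_zero_s11 hx, real_sign_mul, rightSign]
  by_cases h : S.eval x = 0
  · have := (rootMultiplicity_pos hS).2 h
    simp [h, this, mul_assoc]
  · simp [rootMultiplicity_eq_zero h, unitEval_of_eval_ne_zero_s11 h]

theorem indMinus_of_eval_ne_zero {R S : ℝ[X]} (hS : S ≠ 0) {x : ℝ} (hx : R.eval x ≠ 0) :
    indMinus R S x =
      1 / 2 * Real.sign (R.eval x) * (leftSign S x - Real.sign (S.eval x)) := by
  rw [indMinus, rootMultiplicity_eq_zero hx, unitEval_of_eval_ne_zero_s11 hx, real_sign_mul, leftSign]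
  by_cases h : S.eval x = 0
  · have := (rootMultiplicity_pos hS).2 h
    simp [h, this]
    ring
  · simp [rootMultiplicity_eq_zero h, unitEval_of_eval_ne_zero_s11 h]

/-- If the numerator has constant nonzero sign, the Cauchy index only depends on the signs of the
denominator at the endpoints. -/
theorem cauchyIndex_of_sign_eq {R S : ℝ[X]} {a b ε : ℝ} (hab : a < b) (hε : ε ≠ 0)
    (hR : ∀ t ∈ Set.Icc a b, Real.sign (R.eval t) = ε) :
    cauchyIndex R S a b = 1 / 2 * ε * (Real.sign (S.eval b) - Real.sign (S.eval a)) := by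
  have hR0 : ∀ t ∈ Set.Icc a b, R.eval t ≠ 0 := fun t ht h0 =>
    hε (by rw [← hR t ht, h0, Real.sign_zero])
  have ha : a ∈ Set.Icc a b := Set.left_mem_Icc.2 hab.le
  have hb : b ∈ Set.Icc a b := Set.right_mem_Icc.2 hab.le
  by_cases hS : S = 0
  · simp [cauchyIndex, hS]
  have hRne : R ≠ 0 := by rintro rfl; exact hR0 a ha (by simp)
  rw [cauchyIndex, if_neg (by tauto), indPlus_of_eval_ne_zero hS (hR0 a ha),
    indMinus_of_eval_ne_zero hS (hR0 b hb), hR a ha, hR b hb]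
  have hsum : (∑ x ∈ S.roots.toFinset, if a < x ∧ x < b then indPoint R S x else 0) =
      1 / 2 * ε * ∑ x ∈ S.roots.toFinset,
        if a < x ∧ x < b then rightSign S x - leftSign S x else 0 := by
    rw [Finset.mul_sum]
    refine Finset.sum_congr rfl fun x _ => ?_
    split_ifs with h
    · have hx : x ∈ Set.Icc a b := ⟨h.1.le, h.2.le⟩
      rw [indPoint, indPlus_of_eval_ne_zero hS (hR0 x hx),
        indMinus_of_eval_ne_zero hS (hR0 x hx), hR x hx]
      ring
    · simp
  rw [hsum]
  linear_combination 1 / 2 * ε * rightSign_add_sum_sub_leftSign hS hab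

theorem indPlus_eq_zero (R : ℝ[X]) {S : ℝ[X]} {x : ℝ} (hx : S.eval x ≠ 0) :
    indPlus R S x = 0 := by
  simp [indPlus, rootMultiplicity_eq_zero hx]

theorem indMinus_eq_zero (R : ℝ[X]) {S : ℝ[X]} {x : ℝ} (hx : S.eval x ≠ 0) :
    indMinus R S x = 0 := by
  simp [indMinus, rootMultiplicity_eq_zero hx]

theorem cauchyIndex_eq_zero_of_eval_ne_zero (R : ℝ[X]) {S : ℝ[X]} {a b : ℝ} (hab : a ≤ b)
    (hS : ∀ t ∈ Set.Icc a b, S.eval t ≠ 0) : cauchyIndex R S a b = 0 := by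
  rw [cauchyIndex, indPlus_eq_zero R (hS a (Set.left_mem_Icc.2 hab)),
    indMinus_eq_zero R (hS b (Set.right_mem_Icc.2 hab)), Finset.sum_eq_zero]
  · simp
  · intro x _
    split_ifs with h
    · have hx := hS x ⟨h.1.le, h.2.le⟩
      rw [indPoint, indPlus_eq_zero R hx, indMinus_eq_zero R hx, sub_zero]
    · rfl

theorem eval_rePoly (p : ℂ[X]) (t : ℝ) : (rePoly p).eval t = (p.eval (t : ℂ)).re := by
  rw [rePoly, Polynomial.sum, eval_finsetSum, eval_eq_sum, Polynomial.sum, Complex.re_sum]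
  refine Finset.sum_congr rfl fun n _ => ?_
  rw [← Complex.ofReal_pow, Complex.re_mul_ofReal]
  simp

theorem eval_imPoly (p : ℂ[X]) (t : ℝ) : (imPoly p).eval t = (p.eval (t : ℂ)).im := by
  rw [imPoly, Polynomial.sum, eval_finsetSum, eval_eq_sum, Polynomial.sum, Complex.im_sum]
  refine Finset.sum_congr rfl fun n _ => ?_
  rw [← Complex.ofReal_pow, Complex.im_mul_ofReal]
  simp

theorem eval_segPolyXY (F : MvPolynomial (Fin 2) ℂ) (a b : ℂ) (t : ℝ) :
    (segPolyXY F a b).eval (t : ℂ) =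
      evalXY F (a.re + t * (b.re - a.re)) (a.im + t * (b.im - a.im)) := by
  rw [segPolyXY, evalXY, ← Polynomial.coe_aeval_eq_eval, ← AlgHom.comp_apply,
    MvPolynomial.comp_aeval, ← MvPolynomial.coe_aeval_eq_eval, RingHom.coe_coe]
  congr 2
  funext j
  split_ifs <;> simp <;> ring

theorem continuous_evalXY (F : MvPolynomial (Fin 2) ℂ) :
    Continuous fun p : ℝ × ℝ => evalXY F p.1 p.2 := by
  refine (MvPolynomial.continuous_eval F).comp (continuous_pi fun j => ?_)
  split_ifs <;> fun_prop

/-- If `re F` has constant nonzero sign on a rectangle containing `a` and `b`, the index along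
`[a, b]` only depends on the signs of `im F` at the endpoints. -/
theorem segIndexXY_of_sign_re_eq {F : MvPolynomial (Fin 2) ℂ} {I J : Set ℝ} (hI : Convex ℝ I)
    (hJ : Convex ℝ J) {ε : ℝ} (hε : ε ≠ 0)
    (h : ∀ u ∈ I, ∀ v ∈ J, Real.sign (evalXY F u v).re = ε) {a b : ℂ}
    (ha : a.re ∈ I ∧ a.im ∈ J) (hb : b.re ∈ I ∧ b.im ∈ J) :
    segIndexXY F a b = 1 / 4 * ε *
      (Real.sign (evalXY F b.re b.im).im - Real.sign (evalXY F a.re a.im).im) := by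
  rw [segIndexXY, cauchyIndex_of_sign_eq zero_lt_one hε]
  · simp only [eval_imPoly, eval_segPolyXY, zero_mul, add_zero, one_mul, add_sub_cancel]
    ring
  · intro t ht
    rw [eval_rePoly, eval_segPolyXY]
    exact h _ (by simpa using hI.add_smul_sub_mem ha.1 hb.1 ht) _
      (by simpa using hJ.add_smul_sub_mem ha.2 hb.2 ht)

theorem segIndexXY_eq_zero_of_im_ne_zero {F : MvPolynomial (Fin 2) ℂ} {I J : Set ℝ}
    (hI : Convex ℝ I) (hJ : Convex ℝ J)
    (h : ∀ u ∈ I, ∀ v ∈ J, (evalXY F u v).im ≠ 0) {a b : ℂ}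
    (ha : a.re ∈ I ∧ a.im ∈ J) (hb : b.re ∈ I ∧ b.im ∈ J) :
    segIndexXY F a b = 0 := by
  rw [segIndexXY, cauchyIndex_eq_zero_of_eval_ne_zero _ zero_le_one, mul_zero]
  intro t ht
  rw [eval_imPoly, eval_segPolyXY]
  exact h _ (by simpa using hI.add_smul_sub_mem ha.1 hb.1 ht) _
    (by simpa using hJ.add_smul_sub_mem ha.2 hb.2 ht)

theorem exists_forall_Icc_of_eventually {p : ℝ × ℝ → Prop} {x y : ℝ}
    (h : ∀ᶠ q in 𝓝 (x, y), p q) :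
    ∃ δ : ℝ, 0 < δ ∧ ∀ u ∈ Set.Icc (x - δ) (x + δ), ∀ v ∈ Set.Icc (y - δ) (y + δ), p (u, v) := by
  obtain ⟨δ, hδ, hsub⟩ := Metric.nhds_basis_closedBall.mem_iff.1 h
  refine ⟨δ, hδ, fun u hu v hv => hsub ?_⟩
  rw [← closedBall_prod_same, Real.closedBall_eq_Icc, Real.closedBall_eq_Icc]
  exact ⟨hu, hv⟩

/-- Local version: if `F ∈ ℂ[X,Y]` does not vanish at the point `(x, y) ∈ ℝ²`, then
there is `δ > 0` such that `ind_{∂Γ}(F) = 0` for every rectangle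
`Γ ⊆ [x-δ, x+δ] × [y-δ, y+δ]`. -/
theorem rectIndex_eq_zero_local (F : MvPolynomial (Fin 2) ℂ) (x y : ℝ)
    (hF : evalXY F x y ≠ 0) :
    ∃ δ : ℝ, 0 < δ ∧ ∀ x₀ x₁ y₀ y₁ : ℝ, x₀ < x₁ → y₀ < y₁ →
      Set.Icc x₀ x₁ ⊆ Set.Icc (x - δ) (x + δ) → Set.Icc y₀ y₁ ⊆ Set.Icc (y - δ) (y + δ) →
      rectIndexXY F x₀ x₁ y₀ y₁ = 0 := by
  have hcF := continuous_evalXY F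
  have hmem : ∀ {I J : Set ℝ} {u v : ℝ}, u ∈ I → v ∈ J →
      ((u : ℂ) + v * Complex.I).re ∈ I ∧ ((u : ℂ) + v * Complex.I).im ∈ J := fun hu hv => by
    simpa using ⟨hu, hv⟩
  by_cases him : (evalXY F x y).im = 0
  · have hre : (evalXY F x y).re ≠ 0 := fun hre => hF (Complex.ext hre him)
    have hε : Real.sign (evalXY F x y).re ≠ 0 := by rwa [Ne, Real.sign_eq_zero_iff]
    obtain ⟨δ, hδ, h⟩ := exists_forall_Icc_of_eventually
      (eventually_sign_eq (x := (x, y)) (Complex.continuous_re.comp hcF).continuousAt hre)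
    refine ⟨δ, hδ, fun x₀ x₁ y₀ y₁ hx hy hI hJ => ?_⟩
    have hx₀ := hI (Set.left_mem_Icc.2 hx.le)
    have hx₁ := hI (Set.right_mem_Icc.2 hx.le)
    have hy₀ := hJ (Set.left_mem_Icc.2 hy.le)
    have hy₁ := hJ (Set.right_mem_Icc.2 hy.le)
    have key := @segIndexXY_of_sign_re_eq F _ _ (convex_Icc _ _) (convex_Icc _ _) _ hε h
    rw [rectIndexXY, key (hmem hx₀ hy₀) (hmem hx₁ hy₀), key (hmem hx₁ hy₀) (hmem hx₁ hy₁),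
      key (hmem hx₁ hy₁) (hmem hx₀ hy₁), key (hmem hx₀ hy₁) (hmem hx₀ hy₀)]
    ring
  · obtain ⟨δ, hδ, h⟩ := exists_forall_Icc_of_eventually
      ((Complex.continuous_im.comp hcF).continuousAt.eventually_ne (x := (x, y)) him)
    refine ⟨δ, hδ, fun x₀ x₁ y₀ y₁ hx hy hI hJ => ?_⟩
    have hx₀ := hI (Set.left_mem_Icc.2 hx.le)
    have hx₁ := hI (Set.right_mem_Icc.2 hx.le)
    have hy₀ := hJ (Set.left_mem_Icc.2 hy.le)
    have hy₁ := hJ (Set.right_mem_Icc.2 hy.le)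
    have key := @segIndexXY_eq_zero_of_im_ne_zero F _ _ (convex_Icc _ _) (convex_Icc _ _) h
    rw [rectIndexXY, key (hmem hx₀ hy₀) (hmem hx₁ hy₀), key (hmem hx₁ hy₀) (hmem hx₁ hy₁),
      key (hmem hx₁ hy₁) (hmem hx₀ hy₁), key (hmem hx₀ hy₁) (hmem hx₀ hy₀)]
    ring
end
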